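/- Let d₁, d₂ be odd positive integers with d₁ ∣ d₂ and D = diag(d₁,d₂). Then the entrywise reduction-modulo-2 map r₂ : Γ_D(D) → Sp₄(ℤ/2ℤ) is a surjective group homomorphism whose kernel is exactly Γ_D(2D); that is, there is an exact sequence 1 → Γ_D(2D) → Γ_D(D) → Sp₄(ℤ/2ℤ) → 1. -/

import Mathlib

open Matrix

/-- The matrix `J_D = [[0, D], [−D, 0]]` for `D = diag(d₁,d₂)`. -/
def JD (d1 d2 : ℤ) : Matrix (Fin 4) (Fin 4) ℤ :=
  !![0, 0, d1, 0; 0, 0, 0, d2; -d1, 0, 0, 0; 0, -d2, 0, 0]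

/-- The standard symplectic matrix `J = [[0, I₂], [−I₂, 0]]` over `ℤ/2ℤ`. -/
def Jmat2 : Matrix (Fin 4) (Fin 4) (ZMod 2) :=
  (JD 1 1).map (Int.cast)

/-- Membership in `Sp₄(ℤ/2ℤ)`. -/
def IsSp2 (N : Matrix (Fin 4) (Fin 4) (ZMod 2)) : Prop := N * Jmat2 * Nᵀ = Jmat2

/-- Entrywise reduction modulo 2 of an integer matrix. -/
def red2 (M : Matrix (Fin 4) (Fin 4) ℤ) : Matrix (Fin 4) (Fin 4) (ZMod 2) :=
  M.map (Int.cast)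

/-- Membership in the paramodular group `Γ_D`. -/
def InGammaD (d1 d2 : ℤ) (R : Matrix (Fin 4) (Fin 4) ℤ) : Prop :=
  R * JD d1 d2 * Rᵀ = JD d1 d2

/-- The vector `(d₁, d₂, d₁, d₂)` of row divisibilities: the `i`-th row of each 2×2 block of
`M − I₄` must be divisible by `dᵢ`. -/
def dvec (d1 d2 : ℤ) : Fin 4 → ℤ := ![d1, d2, d1, d2]

/-- Membership in `Γ_D(D)`: `M ∈ Γ_D` and each block of `M − I₄` is of the form `D·Y`,
i.e. rows `0,2` of `M − I₄` are divisible by `d₁` and rows `1,3` by `d₂`. -/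
def InGammaDD (d1 d2 : ℤ) (M : Matrix (Fin 4) (Fin 4) ℤ) : Prop :=
  InGammaD d1 d2 M ∧ ∀ i j, dvec d1 d2 i ∣ (M - 1) i j

/-- Membership in `Γ_D(2D)`. -/
def InGammaD2D (d1 d2 : ℤ) (M : Matrix (Fin 4) (Fin 4) ℤ) : Prop :=
  InGammaD d1 d2 M ∧ ∀ i j, 2 * dvec d1 d2 i ∣ (M - 1) i j

def Bf (r u : Fin 4 → ZMod 2) : ZMod 2 := r 0 * u 2 + r 1 * u 3 + r 2 * u 0 + r 3 * u 1

def tv (u r : Fin 4 → ZMod 2) : Fin 4 → ZMod 2 := fun j => r j + Bf r u * u j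

def PP (d1 d2 : ℤ) (N : Matrix (Fin 4) (Fin 4) (ZMod 2)) : Prop :=
  ∃ M : Matrix (Fin 4) (Fin 4) ℤ, InGammaDD d1 d2 M ∧ red2 M = N

lemma PP_one (d1 d2 : ℤ) : PP d1 d2 1 := by
  refine ⟨1, ⟨?_, ?_⟩, ?_⟩
  · simp [InGammaD]
  · simp
  · simp [red2]

lemma red2_mul (M N : Matrix (Fin 4) (Fin 4) ℤ) : red2 (M * N) = red2 M * red2 N := by
  unfold red2
  exact Matrix.map_mul (f := Int.castRingHom (ZMod 2))

lemma PP_mul {d1 d2 : ℤ} {N N' : Matrix (Fin 4) (Fin 4) (ZMod 2)}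
    (h : PP d1 d2 N) (h' : PP d1 d2 N') : PP d1 d2 (N * N') := by
  obtain ⟨M, ⟨hM, hd⟩, rfl⟩ := h
  obtain ⟨M', ⟨hM', hd'⟩, rfl⟩ := h'
  refine ⟨M * M', ⟨?_, ?_⟩, red2_mul _ _⟩
  · unfold InGammaD at *
    calc M * M' * JD d1 d2 * (M * M')ᵀ = M * (M' * JD d1 d2 * M'ᵀ) * Mᵀ := by
          rw [Matrix.transpose_mul]; simp only [Matrix.mul_assoc]
      _ = _ := by rw [hM', hM]
  · intro i j
    have e : M * M' - 1 = (M - 1) * M' + (M' - 1) := by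
      rw [sub_mul, one_mul]; abel
    rw [e, Matrix.add_apply, Matrix.mul_apply]
    exact dvd_add (Finset.dvd_sum fun k _ => Dvd.dvd.mul_right (hd i k) _) (hd' i j)

def TM (d1 d2 : ℤ) (u : Fin 4 → ℤ) : Matrix (Fin 4) (Fin 4) ℤ :=
  Matrix.of fun i j => (1 : Matrix (Fin 4) (Fin 4) ℤ) i j +
    (![d1 * u 2, d2 * u 3, -(d1 * u 0), -(d2 * u 1)] : Fin 4 → ℤ) i * u j

lemma TM_mem (d1 d2 : ℤ) (u : Fin 4 → ℤ) : InGammaDD d1 d2 (TM d1 d2 u) := by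
  constructor
  · unfold InGammaD
    ext i j
    fin_cases i <;> fin_cases j <;>
      simp [TM, JD, Matrix.mul_apply, Fin.sum_univ_four, Matrix.one_apply] <;> ring
  · intro i j
    have : (TM d1 d2 u - 1) i j =
      (![d1 * u 2, d2 * u 3, -(d1 * u 0), -(d2 * u 1)] : Fin 4 → ℤ) i * u j := by
      simp [TM]
    rw [this]
    apply Dvd.dvd.mul_right
    fin_cases i <;> simp [dvec]

lemma odd_cast {d : ℤ} (h : Odd d) : (d : ZMod 2) = 1 := by
  obtain ⟨k, rfl⟩ := h
  push_cast
  rw [show (2 : ZMod 2) = 0 from rfl]; simp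

lemma neg2 (a : ZMod 2) : -a = a := by revert a; decide

lemma two2 : (2 : ZMod 2) = 0 := rfl

lemma B_self (u : Fin 4 → ZMod 2) : Bf u u = 0 := by
  unfold Bf; linear_combination (u 0 * u 2 + u 1 * u 3) * two2

lemma tv_tv (u r : Fin 4 → ZMod 2) : tv u (tv u r) = r := by
  ext j
  have h := B_self u
  unfold Bf at h
  simp only [tv, Bf]
  linear_combination (r 0 * u 2 + r 1 * u 3 + r 2 * u 0 + r 3 * u 1) * u j * (h + two2)

lemma B_tv (u r s : Fin 4 → ZMod 2) : Bf (tv u r) (tv u s) = Bf r s := by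
  have h := B_self u
  unfold Bf at h
  simp only [tv, Bf]
  linear_combination (r 0 * u 2 + r 1 * u 3 + r 2 * u 0 + r 3 * u 1) *
   (s 0 * u 2 + s 1 * u 3 + s 2 * u 0 + s 3 * u 1) * (h + two2)

lemma red2_TM {d1 d2 : ℤ} (h1 : Odd d1) (h2 : Odd d2) (u : Fin 4 → ZMod 2)
    (N : Matrix (Fin 4) (Fin 4) (ZMod 2)) :
    N * red2 (TM d1 d2 (fun i => ((u i).val : ℤ))) = Matrix.of fun i => tv u (N i) := by
  have a1 := odd_cast h1
  have a2 := odd_cast h2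
  ext i j
  fin_cases j <;>
  simp [red2, TM, Matrix.mul_apply, Fin.sum_univ_four, Matrix.one_apply, a1, a2, tv, Bf, neg2] <;>
  ring

lemma PP_tv {d1 d2 : ℤ} (h1 : Odd d1) (h2 : Odd d2) (u : Fin 4 → ZMod 2)
    (N : Matrix (Fin 4) (Fin 4) (ZMod 2)) (h : PP d1 d2 (Matrix.of fun i => tv u (N i))) :
    PP d1 d2 N := by
  have := PP_mul h ⟨_, TM_mem d1 d2 (fun i => ((u i).val : ℤ)), rfl⟩
  rw [red2_TM h1 h2] at this
  convert this using 1
  ext i j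
  exact (congrFun (tv_tv u (N i)) j).symm

lemma PP_tv2 {d1 d2 : ℤ} (h1 : Odd d1) (h2 : Odd d2) (u v : Fin 4 → ZMod 2)
    (N : Matrix (Fin 4) (Fin 4) (ZMod 2)) (h : PP d1 d2 (Matrix.of fun i => tv v (tv u (N i)))) :
    PP d1 d2 N :=
  PP_tv h1 h2 u N (PP_tv h1 h2 v _ h)

lemma eta4 (r : Fin 4 → ZMod 2) : r = ![r 0, r 1, r 2, r 3] := by
  ext i; fin_cases i <;> rfl

set_option maxRecDepth 100000 in
lemma step1 : ∀ r : Fin 4 → ZMod 2, r ≠ 0 →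
    ∃ u v : Fin 4 → ZMod 2, tv v (tv u r) = ![1, 0, 0, 0] := by
  decide

set_option maxRecDepth 100000 in
lemma step2 : ∀ a b c : ZMod 2, 
    ∃ u v : Fin 4 → ZMod 2, tv v (tv u ![1, 0, 0, 0]) = ![1, 0, 0, 0] ∧
      tv v (tv u ![a, b, 1, c]) = ![0, 0, 1, 0] := by
  decide

set_option maxRecDepth 100000 in
lemma step3 : ∀ a b c d : ZMod 2, a * d + b * c = 1 →
    ∃ p q p' q' : ZMod 2, 
      tv ![0, p', 0, q'] (tv ![0, p, 0, q] ![1, 0, 0, 0]) = ![1, 0, 0, 0] ∧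
      tv ![0, p', 0, q'] (tv ![0, p, 0, q] ![0, 0, 1, 0]) = ![0, 0, 1, 0] ∧
      tv ![0, p', 0, q'] (tv ![0, p, 0, q] ![0, a, 0, b]) = ![0, 1, 0, 0] ∧
      tv ![0, p', 0, q'] (tv ![0, p, 0, q] ![0, c, 0, d]) = ![0, 0, 0, 1] := by
  decide

lemma sp_iff (N : Matrix (Fin 4) (Fin 4) (ZMod 2)) :
    IsSp2 N ↔ ∀ i j, Bf (N i) (N j) = Jmat2 i j := by
  unfold IsSp2
  rw [← Matrix.ext_iff]
  refine forall_congr' fun i => forall_congr' fun j => ?_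
  have : (N * Jmat2 * Nᵀ) i j = Bf (N i) (N j) := by
    simp [Jmat2, JD, Matrix.mul_apply, Fin.sum_univ_four, Bf, neg2]
    ring
  rw [this]

def SB (N : Matrix (Fin 4) (Fin 4) (ZMod 2)) : Prop := ∀ i j, Bf (N i) (N j) = Jmat2 i j

lemma SB_tv2 (u v : Fin 4 → ZMod 2) {N : Matrix (Fin 4) (Fin 4) (ZMod 2)} (h : SB N) :
    SB (Matrix.of fun i => tv v (tv u (N i))) := by
  intro i j
  exact ((B_tv v _ _).trans (B_tv u _ _)).trans (h i j)

lemma surj {d1 d2 : ℤ} (h1 : Odd d1) (h2 : Odd d2) (N : Matrix (Fin 4) (Fin 4) (ZMod 2))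
    (h : SB N) : PP d1 d2 N := by
  have hne : N 0 ≠ 0 := by
    intro h0
    have := h 0 2
    rw [h0] at this
    simp [Bf, Jmat2, JD] at this
  obtain ⟨u, v, huv⟩ := step1 _ hne
  apply PP_tv2 h1 h2 u v
  have hS := SB_tv2 u v h
  have hN0 : (Matrix.of fun i => tv v (tv u (N i))) 0 = ![1, 0, 0, 0] := huv
  generalize (Matrix.of fun i => tv v (tv u (N i))) = N1 at hS hN0 ⊢
  clear huv hne h N u v
  have h22 : N1 2 2 = 1 := by
    have := hS 0 2
    rw [hN0] at this
    simpa [Bf, Jmat2, JD] using this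
  obtain ⟨u, v, hu0, hu2⟩ := step2 (N1 2 0) (N1 2 1) (N1 2 3)
  have e2 := eta4 (N1 2)
  rw [h22] at e2
  rw [← e2] at hu2
  rw [← hN0] at hu0
  apply PP_tv2 h1 h2 u v
  have hS2 := SB_tv2 u v hS
  have hM0 : (Matrix.of fun i => tv v (tv u (N1 i))) 0 = ![1, 0, 0, 0] := hu0.trans hN0
  have hM2 : (Matrix.of fun i => tv v (tv u (N1 i))) 2 = ![0, 0, 1, 0] := hu2
  generalize (Matrix.of fun i => tv v (tv u (N1 i))) = N at hS2 hM0 hM2 ⊢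
  clear hu0 hu2 e2 h22 hS hN0 N1 u v
  have a1 := hS2 0 1
  have a2 := hS2 0 3
  have a3 := hS2 2 1
  have a4 := hS2 2 3
  have a5 := hS2 1 3
  rw [hM0] at a1 a2
  rw [hM2] at a3 a4
  simp [Bf, Jmat2, JD] at a1 a2 a3 a4 a5
  simp [a1, a2, a3, a4] at a5
  obtain ⟨p, q, p', q', b0, b2, b1, b3⟩ := step3 (N 1 1) (N 1 3) (N 3 1) (N 3 3) a5
  have e1 := eta4 (N 1)
  have e3 := eta4 (N 3)
  rw [a1, a3] at e1
  rw [a2, a4] at e3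
  rw [← e1] at b1
  rw [← e3] at b3
  rw [← hM0] at b0
  rw [← hM2] at b2
  apply PP_tv2 h1 h2 _ _ N
  convert PP_one d1 d2
  swap
  · exact ![0, p, 0, q]
  swap
  · exact ![0, p', 0, q']
  have c0 := b0.trans hM0
  have c2 := b2.trans hM2
  ext i j
  fin_cases i
  · refine (congrFun c0 j).trans ?_
    revert j; decide
  · refine (congrFun b1 j).trans ?_
    revert j; decide
  · refine (congrFun c2 j).trans ?_
    revert j; decide
  · refine (congrFun b3 j).trans ?_
    revert j; decide

theorem statement2 (d1 d2 : ℤ) (h1 : Odd d1) (h1p : 0 < d1) (h2 : Odd d2) (h2p : 0 < d2)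
    (hdvd : d1 ∣ d2) :
    (∀ M : Matrix (Fin 4) (Fin 4) ℤ, InGammaDD d1 d2 M → IsSp2 (red2 M)) ∧
    (∀ N : Matrix (Fin 4) (Fin 4) (ZMod 2), IsSp2 N →
      ∃ M : Matrix (Fin 4) (Fin 4) ℤ, InGammaDD d1 d2 M ∧ red2 M = N) ∧
    (∀ M : Matrix (Fin 4) (Fin 4) ℤ, InGammaDD d1 d2 M →
      (red2 M = 1 ↔ InGammaD2D d1 d2 M)) := by
  refine ⟨?_, ?_, ?_⟩
  · rintro M ⟨hM, -⟩
    have hJ : red2 (JD d1 d2) = Jmat2 := by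
      have a1 := odd_cast h1
      have a2 := odd_cast h2
      ext i j
      fin_cases i <;> fin_cases j <;> simp [red2, JD, Jmat2, a1, a2]
    have := congrArg red2 hM
    rw [red2_mul, red2_mul, hJ] at this
    exact this
  · intro N hN
    exact surj h1 h2 N ((sp_iff N).1 hN)
  · rintro M ⟨hM, hd⟩
    have key : red2 M = 1 ↔ ∀ i j, (2 : ℤ) ∣ (M - 1) i j := by
      rw [← Matrix.ext_iff]
      refine forall_congr' fun i => forall_congr' fun j => ?_
      have := ZMod.intCast_zmod_eq_zero_iff_dvd ((M - 1) i j) 2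
      push_cast at this
      rw [← this, Matrix.sub_apply, Int.cast_sub, sub_eq_zero]
      simp [red2, Matrix.one_apply]
    rw [key]
    constructor
    · intro h
      refine ⟨hM, fun i j => ?_⟩
      refine IsCoprime.mul_dvd ?_ (h i j) (hd i j)
      have c1 : IsCoprime 2 d1 := Int.isCoprime_iff_gcd_eq_one.2 (by
        simpa using Int.isCoprime_iff_gcd_eq_one.1 (Int.isCoprime_two_left.2 h1))
      have c2 : IsCoprime 2 d2 := Int.isCoprime_two_left.2 h2
      fin_cases i <;> simp [dvec, c1, c2]
    · rintro ⟨-, h⟩ i j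
      exact dvd_of_mul_right_dvd (h i j)
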